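/- Let G be the group presented by ⟨a, b ∣ a² = b²⟩ with α, β the images of the generators, and let V = (ZMod 2) × (ZMod 2) be the Klein four-group (written additively, or multiplicatively via Multiplicative). There is a well-defined group homomorphism φ : G → V with φ(α) = (1,0) and φ(β) = (0,1) (the relator a²b⁻² is sent to the identity); φ is surjective; and the kernel of φ is isomorphic as a group to ℤ × ℤ. Hence G is an extension of ℤ ⊕ ℤ by the Klein 4-group. -/

import Mathlib

/-- The single relator `a * a * b⁻¹ * b⁻¹` presenting `⟨a, b ∣ a² = b²⟩`. -/
def rels : Set (FreeGroup (Fin 2)) :=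
  {FreeGroup.of 0 * FreeGroup.of 0 * (FreeGroup.of 1)⁻¹ * (FreeGroup.of 1)⁻¹}

namespace KleinBottleGroup

open PresentedGroup

/-- The generator `α`. -/
def α : PresentedGroup rels := of 0

/-- The generator `β`. -/
def β : PresentedGroup rels := of 1

/-- The element `α * β⁻¹`, which is inverted under conjugation by `α`. -/
def τ : PresentedGroup rels := α * β⁻¹

/-- A pair of elements with equal squares defines a homomorphism from `⟨a, b ∣ a² = b²⟩`. -/
def lift {H : Type*} [Group H] (x y : H) (h : x * x = y * y) : PresentedGroup rels →* H :=
  toGroup (f := ![x, y]) (by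
    rintro r rfl
    simp [h])

@[simp]
theorem lift_α {H : Type*} [Group H] (x y : H) (h : x * x = y * y) : lift x y h α = x :=
  toGroup.of _

@[simp]
theorem lift_β {H : Type*} [Group H] (x y : H) (h : x * x = y * y) : lift x y h β = y :=
  toGroup.of _

theorem α_mul_α : α * α = β * β := by
  have h : α * α * β⁻¹ * β⁻¹ = 1 := one_of_mem (rels := rels) rfl
  rwa [mul_inv_eq_one, mul_inv_eq_iff_eq_mul] at h

theorem β_eq : β = τ⁻¹ * α := by
  simp [τ]

theorem semiconjBy_α_τ : SemiconjBy α τ τ⁻¹ := by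
  simp only [SemiconjBy, τ, mul_inv_rev, inv_inv, inv_mul_cancel_right]
  rw [← mul_assoc, α_mul_α, mul_inv_cancel_right]

theorem α_mul_τ_zpow (m : ℤ) : α * τ ^ m = τ ^ (-m) * α := by
  simpa using (semiconjBy_α_τ.zpow_right m).eq

theorem α_inv_mul_τ_zpow (m : ℤ) : α⁻¹ * τ ^ m = τ ^ (-m) * α⁻¹ := by
  rw [inv_mul_eq_iff_eq_mul, ← mul_assoc, α_mul_τ_zpow, neg_neg, mul_inv_cancel_right]

theorem commute_α_sq_τ : Commute (α ^ (2 : ℤ)) τ := by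
  have h := semiconjBy_α_τ.inv_right.mul_left semiconjBy_α_τ
  rwa [inv_inv, ← zpow_two] at h

/-- Every element has the normal form `τ ^ m * α ^ n`. -/
theorem exists_eq_zpow_mul_zpow (g : PresentedGroup rels) : ∃ m n : ℤ, g = τ ^ m * α ^ n := by
  have hg : g ∈ Subgroup.closure (Set.range (of (rels := rels))) := by
    rw [closure_range_of]; trivial
  have hα (m n : ℤ) : α * (τ ^ m * α ^ n) = τ ^ (-m) * α ^ (1 + n) := by
    rw [← mul_assoc, α_mul_τ_zpow, mul_assoc, zpow_one_add]
  have hα' (m n : ℤ) : α⁻¹ * (τ ^ m * α ^ n) = τ ^ (-m) * α ^ (-1 + n) := by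
    rw [← mul_assoc, α_inv_mul_τ_zpow, mul_assoc, zpow_add, zpow_neg_one]
  induction hg using Subgroup.closure_induction_left with
  | one => exact ⟨0, 0, by simp⟩
  | mul_left x hx y _ ih =>
    obtain ⟨i, rfl⟩ := hx
    obtain ⟨m, n, rfl⟩ := ih
    fin_cases i
    · exact ⟨_, _, hα m n⟩
    · refine ⟨-1 + -m, 1 + n, ?_⟩
      change β * _ = _
      rw [β_eq, mul_assoc, hα, zpow_add τ, zpow_neg_one, mul_assoc]
  | inv_mul_cancel x hx y _ ih =>
    obtain ⟨i, rfl⟩ := hx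
    obtain ⟨m, n, rfl⟩ := ih
    fin_cases i
    · exact ⟨_, _, hα' m n⟩
    · refine ⟨-(1 + m), -1 + n, ?_⟩
      change β⁻¹ * _ = _
      rw [β_eq, mul_inv_rev, inv_inv, mul_assoc, ← mul_assoc τ, ← zpow_one_add, hα']

/-- The homomorphism onto the Klein four-group. -/
def toKleinFour : PresentedGroup rels →* Multiplicative (ZMod 2 × ZMod 2) :=
  lift (.ofAdd (1, 0)) (.ofAdd (0, 1)) (by decide)

theorem toKleinFour_zpow_mul_zpow (m n : ℤ) :
    toKleinFour (τ ^ m * α ^ n) = .ofAdd ((m + n : ZMod 2), (m : ZMod 2)) := by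
  have h : -(1 : ZMod 2) = 1 := by decide
  apply Multiplicative.toAdd.injective
  ext <;> simp [toKleinFour, τ, h]

theorem toKleinFour_surjective : Function.Surjective toKleinFour := by
  have h : ∀ v : Multiplicative (ZMod 2 × ZMod 2), ∃ m n : Fin 2,
      v = .ofAdd ((((m : ℕ) : ℤ) + ((n : ℕ) : ℤ) : ZMod 2), (((m : ℕ) : ℤ) : ZMod 2)) := by
    decide
  intro v
  obtain ⟨m, n, hv⟩ := h v
  exact ⟨τ ^ ((m : ℕ) : ℤ) * α ^ ((n : ℕ) : ℤ), by rw [toKleinFour_zpow_mul_zpow, hv]⟩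

/-- The glide reflection `(x, y) ↦ (c - x, y + 1)` of the lattice. -/
def glide (c : ℤ) : Equiv.Perm (ℤ × ℤ) :=
  (Equiv.subLeft c).prodCongr (Equiv.addRight 1)

/-- The action on the lattice as the fundamental group of a Klein bottle. -/
def latticeAction : PresentedGroup rels →* Equiv.Perm (ℤ × ℤ) :=
  lift (glide 0) (glide (-1)) (by ext p <;> simp [glide])

theorem latticeAction_τ : latticeAction τ = (Equiv.addRight 1).prodCongr (Equiv.refl ℤ) := by
  rw [τ, map_mul, map_inv, mul_inv_eq_iff_eq_mul]
  ext p
  · simp [latticeAction, glide]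
    ring
  · simp [latticeAction, glide]

theorem latticeAction_τ_zpow (m : ℤ) (p : ℤ × ℤ) :
    latticeAction (τ ^ m) p = (p.1 + m, p.2) := by
  have h (k : ℕ) (q : ℤ × ℤ) : latticeAction (τ ^ k) q = (q.1 + k, q.2) := by
    induction k with
    | zero => simp
    | succ k ih =>
      rw [pow_succ', map_mul, Equiv.Perm.mul_apply, ih, latticeAction_τ]
      simp [add_assoc]
  obtain ⟨k, rfl | rfl⟩ := m.eq_nat_or_neg
  · simpa using h k p
  · rw [zpow_neg, zpow_natCast, map_inv, Equiv.Perm.inv_eq_iff_eq, h]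
    simp

theorem latticeAction_α_zpow_snd (n : ℤ) (p : ℤ × ℤ) :
    (latticeAction (α ^ n) p).2 = p.2 + n := by
  have h (k : ℕ) (q : ℤ × ℤ) : (latticeAction (α ^ k) q).2 = q.2 + k := by
    induction k with
    | zero => simp
    | succ k ih =>
      rw [pow_succ', map_mul, Equiv.Perm.mul_apply]
      simp [latticeAction, glide] at ih ⊢
      rw [ih, add_assoc]
  obtain ⟨k, rfl | rfl⟩ := n.eq_nat_or_neg
  · simpa using h k p
  · obtain ⟨q, rfl⟩ := (latticeAction (α ^ k)).surjective p
    rw [h, ← Equiv.Perm.mul_apply, ← map_mul]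
    simp

/-- The normal form `τ ^ m * α ^ n` is unique. -/
theorem zpow_mul_zpow_eq_one_iff {m n : ℤ} : τ ^ m * α ^ n = 1 ↔ m = 0 ∧ n = 0 := by
  refine ⟨fun h ↦ ?_, by rintro ⟨rfl, rfl⟩; simp⟩
  have hn : n = 0 := by
    have := congrArg (fun g ↦ (latticeAction g 0).2) h
    simpa only [map_mul, Equiv.Perm.mul_apply, latticeAction_τ_zpow, latticeAction_α_zpow_snd,
      map_one, Equiv.Perm.one_apply, Prod.snd_zero, zero_add] using this
  subst hn
  have := congrArg (fun g ↦ (latticeAction g 0).1) h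
  simp only [zpow_zero, mul_one, latticeAction_τ_zpow] at this
  simpa using this

/-- The embedding of `ℤ × ℤ` with image generated by `τ ^ 2` and `α ^ 2`. -/
def ofLattice : Multiplicative (ℤ × ℤ) →* PresentedGroup rels :=
  MonoidHom.mk' (fun v ↦ τ ^ (2 * v.toAdd.1) * α ^ (2 * v.toAdd.2)) fun v w ↦ by
    have h := (commute_α_sq_τ.zpow_zpow v.toAdd.2 (2 * w.toAdd.1)).eq
    rw [← zpow_mul] at h
    simp only [toAdd_mul, Prod.fst_add, Prod.snd_add, mul_add, zpow_add, mul_assoc]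
    rw [← mul_assoc (α ^ _) (τ ^ _), h, mul_assoc]

theorem ofLattice_apply (v : Multiplicative (ℤ × ℤ)) :
    ofLattice v = τ ^ (2 * v.toAdd.1) * α ^ (2 * v.toAdd.2) :=
  rfl

theorem ofLattice_injective : Function.Injective ofLattice := by
  refine (injective_iff_map_eq_one _).2 fun v hv ↦ ?_
  rw [ofLattice_apply, zpow_mul_zpow_eq_one_iff] at hv
  apply Multiplicative.toAdd.injective
  ext
  · simpa using hv.1
  · simpa using hv.2

theorem range_ofLattice : ofLattice.range = toKleinFour.ker := by
  ext g
  rw [MonoidHom.mem_range, MonoidHom.mem_ker]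
  constructor
  · rintro ⟨v, rfl⟩
    have h : (2 : ZMod 2) = 0 := by decide
    rw [ofLattice_apply, toKleinFour_zpow_mul_zpow]
    simp [h]
  · intro hg
    obtain ⟨m, n, rfl⟩ := exists_eq_zpow_mul_zpow g
    rw [toKleinFour_zpow_mul_zpow, ofAdd_eq_one, Prod.mk_eq_zero] at hg
    obtain ⟨hmn, hm⟩ := hg
    rw [hm, zero_add, ZMod.intCast_zmod_eq_zero_iff_dvd] at hmn
    rw [ZMod.intCast_zmod_eq_zero_iff_dvd] at hm
    obtain ⟨k, rfl⟩ := hm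
    obtain ⟨l, rfl⟩ := hmn
    exact ⟨.ofAdd (k, l), rfl⟩

/-- The kernel of the map onto the Klein four-group is free abelian of rank two. -/
noncomputable def kerEquiv : toKleinFour.ker ≃* Multiplicative (ℤ × ℤ) :=
  ((MonoidHom.ofInjective ofLattice_injective).trans
    (MulEquiv.subgroupCongr range_ofLattice)).symm

end KleinBottleGroup

/-- `G = ⟨a, b ∣ a² = b²⟩` is an extension of `ℤ ⊕ ℤ` by the Klein 4-group
`V = (ZMod 2) × (ZMod 2)`: there is a (well-defined) surjective group
homomorphism `φ : G → V` with `φ(α) = (1,0)` and `φ(β) = (0,1)`, whose kernel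
is isomorphic to `ℤ × ℤ`. -/
theorem extension_by_klein_four :
    ∃ φ : PresentedGroup rels →* Multiplicative (ZMod 2 × ZMod 2),
      φ (PresentedGroup.of 0) = Multiplicative.ofAdd (1, 0)
      ∧ φ (PresentedGroup.of 1) = Multiplicative.ofAdd (0, 1)
      ∧ Function.Surjective φ
      ∧ Nonempty (φ.ker ≃* Multiplicative (ℤ × ℤ)) := by
  exact ⟨KleinBottleGroup.toKleinFour, KleinBottleGroup.lift_α .., KleinBottleGroup.lift_β ..,
    KleinBottleGroup.toKleinFour_surjective, ⟨KleinBottleGroup.kerEquiv⟩⟩
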